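/- arXiv:0805.3824 — 2 statements merged into one kernel-verified Lean document; each statement's English description precedes it below -/
import Mathlib

section
/- For every A ∈ 𝔽_q^{N×n}, the coherent discrepancy function Δ_A is normal: for all X, X' ∈ 𝔽_q^{n×m} and every integer i with 0 ≤ i ≤ δ_A(X,X'), there exists Y ∈ 𝔽_q^{N×m} such that Δ_A(X,Y) = i and Δ_A(X',Y) = δ_A(X,X') − i. -/
/-- The coherent discrepancy `Δ_A(X,Y)`: the least `r` such that
`Y = AX + DZ` for some `D ∈ 𝔽_q^{N×r}` and `Z ∈ 𝔽_q^{r×m}`. -/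
noncomputable def discA {K : Type*} [Field K] [Fintype K] {n m N : ℕ}
    (A : Matrix (Fin N) (Fin n) K) (X : Matrix (Fin n) (Fin m) K)
    (Y : Matrix (Fin N) (Fin m) K) : ℕ :=
  sInf {r : ℕ | ∃ D : Matrix (Fin N) (Fin r) K, ∃ Z : Matrix (Fin r) (Fin m) K,
    Y = A * X + D * Z}

/-- The Δ-distance `δ_A(X,X') = min_Y (Δ_A(X,Y) + Δ_A(X',Y))`. -/
noncomputable def deltaA {K : Type*} [Field K] [Fintype K] {n m N : ℕ}
    (A : Matrix (Fin N) (Fin n) K) (X X' : Matrix (Fin n) (Fin m) K) : ℕ :=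
  sInf {e : ℕ | ∃ Y : Matrix (Fin N) (Fin m) K, e = discA A X Y + discA A X' Y}

/-- The product of two matrices with inner dimension `i + j` splits into the product of the
first `i` columns and rows and the product of the last `j` columns and rows. -/
theorem mul_eq_castAdd_mul_add_natAdd_mul {K : Type*} [Semiring K] {m N i j : ℕ}
    (D : Matrix (Fin N) (Fin (i + j)) K) (Z : Matrix (Fin (i + j)) (Fin m) K) :
    D * Z = D.submatrix id (Fin.castAdd j) * Z.submatrix (Fin.castAdd j) id +
      D.submatrix id (Fin.natAdd i) * Z.submatrix (Fin.natAdd i) id := by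
  ext a b
  simp [Matrix.mul_apply, Fin.sum_univ_add]

section

variable {K : Type*} [Field K] [Fintype K] {n m N : ℕ} {A : Matrix (Fin N) (Fin n) K}

theorem discA_le {X : Matrix (Fin n) (Fin m) K} {Y : Matrix (Fin N) (Fin m) K} {r : ℕ}
    (D : Matrix (Fin N) (Fin r) K) (Z : Matrix (Fin r) (Fin m) K) (h : Y = A * X + D * Z) :
    discA A X Y ≤ r :=
  Nat.sInf_le ⟨D, Z, h⟩

variable (A) in
theorem exists_eq_add_mul_discA (X : Matrix (Fin n) (Fin m) K) (Y : Matrix (Fin N) (Fin m) K) :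
    ∃ D : Matrix (Fin N) (Fin (discA A X Y)) K, ∃ Z : Matrix (Fin (discA A X Y)) (Fin m) K,
      Y = A * X + D * Z :=
  Nat.sInf_mem (s := {r : ℕ | ∃ D : Matrix (Fin N) (Fin r) K, ∃ Z : Matrix (Fin r) (Fin m) K,
    Y = A * X + D * Z}) ⟨N, 1, Y - A * X, by simp⟩

theorem deltaA_le (X X' : Matrix (Fin n) (Fin m) K) (Y : Matrix (Fin N) (Fin m) K) :
    deltaA A X X' ≤ discA A X Y + discA A X' Y :=
  Nat.sInf_le ⟨Y, rfl⟩

variable (A) in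
theorem exists_deltaA_eq (X X' : Matrix (Fin n) (Fin m) K) :
    ∃ Y : Matrix (Fin N) (Fin m) K, deltaA A X X' = discA A X Y + discA A X' Y :=
  Nat.sInf_mem (s := {e : ℕ | ∃ Y : Matrix (Fin N) (Fin m) K,
    e = discA A X Y + discA A X' Y}) ⟨_, 0, rfl⟩

variable (A) in
theorem exists_eq_add_mul_deltaA (X X' : Matrix (Fin n) (Fin m) K) :
    ∃ D : Matrix (Fin N) (Fin (deltaA A X X')) K, ∃ Z : Matrix (Fin (deltaA A X X')) (Fin m) K,
      A * X' = A * X + D * Z := by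
  obtain ⟨Y, hY⟩ := exists_deltaA_eq A X X'
  obtain ⟨D₁, Z₁, h₁⟩ := exists_eq_add_mul_discA A X Y
  obtain ⟨D₂, Z₂, h₂⟩ := exists_eq_add_mul_discA A X' Y
  rw [hY]
  refine ⟨(Matrix.fromCols D₁ (-D₂)).submatrix id finSumFinEquiv.symm,
    (Matrix.fromRows Z₁ Z₂).submatrix finSumFinEquiv.symm id, ?_⟩
  rw [Matrix.submatrix_mul_equiv, Matrix.submatrix_id_id, Matrix.fromCols_mul_fromRows,
    Matrix.neg_mul, ← add_assoc, ← h₁, ← sub_eq_add_neg]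
  exact eq_sub_of_add_eq h₂.symm

end

/-- The coherent discrepancy function `Δ_A` is normal: for all `X, X'` and
every `0 ≤ i ≤ δ_A(X,X')` there is a `Y` with `Δ_A(X,Y) = i` and
`Δ_A(X',Y) = δ_A(X,X') − i`. -/
theorem discA_isNormal {K : Type*} [Field K] [Fintype K] {n m N : ℕ}
    (hn : 0 < n) (hm : 0 < m) (hN : 0 < N)
    (A : Matrix (Fin N) (Fin n) K) (X X' : Matrix (Fin n) (Fin m) K)
    (i : ℕ) (hi : i ≤ deltaA A X X') :
    ∃ Y : Matrix (Fin N) (Fin m) K,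
      discA A X Y = i ∧ discA A X' Y = deltaA A X X' - i := by
  obtain ⟨D, Z, h⟩ := exists_eq_add_mul_deltaA A X X'
  have hle := deltaA_le (A := A) X X'
  generalize deltaA A X X' = d at *
  obtain ⟨j, rfl⟩ := Nat.exists_eq_add_of_le hi
  rw [mul_eq_castAdd_mul_add_natAdd_mul] at h
  refine ⟨A * X + D.submatrix id (Fin.castAdd j) * Z.submatrix (Fin.castAdd j) id, ?_⟩
  specialize hle (A * X + D.submatrix id (Fin.castAdd j) * Z.submatrix (Fin.castAdd j) id)
  have h₁ := discA_le (A := A) (X := X) _ _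
    (rfl : _ = A * X + D.submatrix id (Fin.castAdd j) * Z.submatrix (Fin.castAdd j) id)
  have h₂ : discA A X'
      (A * X + D.submatrix id (Fin.castAdd j) * Z.submatrix (Fin.castAdd j) id) ≤ j := by
    refine discA_le (-D.submatrix id (Fin.natAdd i)) (Z.submatrix (Fin.natAdd i) id) ?_
    rw [h, Matrix.neg_mul]
    abel
  omega
end

section
/- Let ρ, σ ∈ ℕ and let L ≥ max{n − ρ, N − σ}. For all X ∈ 𝔽_q^{n×m} and Y ∈ 𝔽_q^{N×m}, the minimum of rank(BY − AX) over all A ∈ 𝔽_q^{L×n} with rank A ≥ n − ρ and all B ∈ 𝔽_q^{L×N} with rank B ≥ N − σ equals [max{rank X − ρ, rank Y − σ} − dim(⟨X⟩ ∩ ⟨Y⟩)]⁺. In particular, this minimum is independent of L. -/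
/-- The row space of a matrix: the span of its rows in `𝔽_q^m`. -/
noncomputable def rowSpace {K : Type*} [Field K] {a b : ℕ}
    (X : Matrix (Fin a) (Fin b) K) : Submodule K (Fin b → K) :=
  Submodule.span K (Set.range fun i => X i)

/-- Rank-nullity for the restriction of a linear map to a subspace. -/
theorem finrank_map_add_finrank_ker_inf {K U V : Type*} [Field K] [AddCommGroup U] [Module K U]
    [FiniteDimensional K U] [AddCommGroup V] [Module K V] (f : U →ₗ[K] V) (W : Submodule K U) :
    Module.finrank K (W.map f) + Module.finrank K ↥(LinearMap.ker f ⊓ W) = Module.finrank K W := by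
  have h := LinearMap.finrank_range_add_finrank_ker (f.domRestrict W)
  rw [LinearMap.range_domRestrict, LinearMap.ker_domRestrict] at h
  rw [← h, inf_comm, ← Submodule.map_comap_subtype, Submodule.finrank_map_subtype_eq]

/-- A subspace `S` can be enlarged by `r` vectors of `T` up to any dimension
not exceeding `r + dim S` and `dim (S + T)`. -/
theorem exists_le_finrank_sup_span_range {K U : Type*} [Field K] [AddCommGroup U] [Module K U]
    [FiniteDimensional K U] (T : Submodule K U) (r P : ℕ) (S : Submodule K U)
    (hr : P ≤ r + Module.finrank K S) (hT : P ≤ Module.finrank K ↥(S ⊔ T)) :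
    ∃ v : Fin r → U, (∀ i, v i ∈ T) ∧
      P ≤ Module.finrank K ↥(S ⊔ Submodule.span K (Set.range v)) := by
  induction r generalizing S with
  | zero =>
    exact ⟨Fin.elim0, fun i => i.elim0,
      (by omega : P ≤ Module.finrank K S).trans (Submodule.finrank_mono le_sup_left)⟩
  | succ r ih =>
    by_cases hP : P ≤ Module.finrank K S
    · exact ⟨0, fun i => T.zero_mem, hP.trans (Submodule.finrank_mono le_sup_left)⟩
    · have hTS : ¬ T ≤ S := fun h => by
        rw [sup_eq_left.mpr h] at hT
        exact hP hT
      obtain ⟨w, hwT, hwS⟩ := SetLike.not_le_iff_exists.mp hTS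
      have hlt : S < S ⊔ Submodule.span K {w} :=
        lt_of_le_of_ne le_sup_left fun h => hwS <| by
          rw [h]
          exact Submodule.mem_sup_right (Submodule.mem_span_singleton_self w)
      have hlt' := Submodule.finrank_lt_finrank_of_lt hlt
      obtain ⟨v, hv, hPv⟩ := ih (S ⊔ Submodule.span K {w}) (by omega)
        (hT.trans (Submodule.finrank_mono (sup_le_sup_right le_sup_left T)))
      refine ⟨Fin.cons w v, Fin.cases hwT hv, ?_⟩
      rwa [Fin.range_cons, Submodule.span_insert, ← sup_assoc]

/-- Given linearly independent vectors `z` in the row space of `X`, there is a matrix `A` of rank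
at least `P` such that the rows of `A * X` are the vectors `z`, then `r` unspecified rows, then
`t` zero rows. -/
theorem exists_matrix_rank_ge_mul_row_eq {K : Type*} [Field K] {n m d r t L : ℕ}
    (e : Fin L ≃ Fin d ⊕ Fin r ⊕ Fin t) (X : Matrix (Fin n) (Fin m) K)
    (z : Fin d → Fin m → K) (hz : LinearIndependent K z) (hzX : ∀ i, z i ∈ rowSpace X) (P : ℕ)
    (hPn : P ≤ n) (hPL : P ≤ L) (hP : P + X.rank ≤ d + r + n) :
    ∃ A : Matrix (Fin L) (Fin n) K, P ≤ A.rank ∧ (∀ i, (A * X) (e.symm (Sum.inl i)) = z i) ∧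
      ∀ i, (A * X) (e.symm (Sum.inr (Sum.inr i))) = 0 := by
  have hL : L = d + (r + t) := by simpa using Fintype.card_congr e
  have hrange : LinearMap.range X.vecMulLinear = rowSpace X := range_vecMulLinear X
  have hker : X.rank + Module.finrank K (LinearMap.ker X.vecMulLinear) = n := by
    have h := LinearMap.finrank_range_add_finrank_ker X.vecMulLinear
    rw [range_vecMulLinear X, ← X.rank_eq_finrank_span_row] at h
    simpa using h
  have hx : ∀ i, ∃ x, X.vecMulLinear x = z i := fun i => by
    rw [← LinearMap.mem_range, hrange]
    exact hzX i
  choose x hx using hx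
  have hxli : LinearIndependent K x := by
    refine LinearIndependent.of_comp X.vecMulLinear ?_
    rwa [show X.vecMulLinear ∘ x = z from funext hx]
  set S := Submodule.span K (Set.range x)
  have hSd : Module.finrank K S = d := by simpa using finrank_span_eq_card hxli
  have hSk : d + Module.finrank K (LinearMap.ker X.vecMulLinear) ≤
      Module.finrank K ↥(S ⊔ LinearMap.ker X.vecMulLinear) := by
    rw [← finrank_map_add_finrank_ker_inf X.vecMulLinear (S ⊔ _),
      inf_eq_left.mpr (le_sup_right : LinearMap.ker X.vecMulLinear ≤ S ⊔ _)]
    refine Nat.add_le_add_right ?_ _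
    have hzd : Module.finrank K (Submodule.span K (Set.range z)) = d := by
      simpa using finrank_span_eq_card hz
    rw [← hzd]
    refine Submodule.finrank_mono (Submodule.span_le.mpr ?_)
    rintro _ ⟨i, rfl⟩
    exact ⟨x i, Submodule.mem_sup_left (Submodule.subset_span ⟨i, rfl⟩), hx i⟩
  obtain ⟨w, hw, hwS⟩ := exists_le_finrank_sup_span_range (LinearMap.ker X.vecMulLinear) t
    (d + min t (Module.finrank K (LinearMap.ker X.vecMulLinear))) S (by omega) (by omega)
  obtain ⟨v, -, hv⟩ := exists_le_finrank_sup_span_range ⊤ r P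
    (S ⊔ Submodule.span K (Set.range w)) (by omega)
    (by rwa [sup_top_eq, finrank_top, Module.finrank_fin_fun])
  refine ⟨Matrix.of (Sum.elim x (Sum.elim v w) ∘ e), ?_, fun i => ?_, fun i => ?_⟩
  · rw [Matrix.rank_eq_finrank_span_row]
    change P ≤ Module.finrank K (Submodule.span K (Set.range (Sum.elim x (Sum.elim v w) ∘ e)))
    rw [e.surjective.range_comp, Set.Sum.elim_range, Set.Sum.elim_range, Submodule.span_union,
      Submodule.span_union, sup_comm (Submodule.span K (Set.range v)), ← sup_assoc]
    exact hv
  · rw [Matrix.mul_apply_eq_vecMul, ← hx i]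
    change Matrix.vecMul ((Sum.elim x (Sum.elim v w) ∘ e) _) X = _
    simp
  · rw [Matrix.mul_apply_eq_vecMul]
    change Matrix.vecMul ((Sum.elim x (Sum.elim v w) ∘ e) _) X = _
    simpa using hw i

/-- A matrix with at most `r` nonzero rows has rank at most `r`. -/
theorem rank_le_of_rows_eq_zero {K : Type*} [Field K] {m d r t L : ℕ}
    (e : Fin L ≃ Fin d ⊕ Fin r ⊕ Fin t) (C : Matrix (Fin L) (Fin m) K)
    (hl : ∀ i, C (e.symm (Sum.inl i)) = 0) (hr : ∀ i, C (e.symm (Sum.inr (Sum.inr i))) = 0) :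
    C.rank ≤ r := by
  rw [Matrix.rank_eq_finrank_span_row]
  have h : Submodule.span K (Set.range C.row) ≤
      Submodule.span K (Set.range fun i : Fin r => C (e.symm (Sum.inr (Sum.inl i)))) := by
    refine Submodule.span_le.mpr ?_
    rintro _ ⟨j, rfl⟩
    obtain ⟨k, rfl⟩ := e.symm.surjective j
    change C (e.symm k) ∈ _
    rcases k with i | i | i
    · rw [hl]
      exact Submodule.zero_mem _
    · exact Submodule.subset_span ⟨i, rfl⟩
    · rw [hr]
      exact Submodule.zero_mem _
  refine (Submodule.finrank_mono h).trans ?_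
  simpa [Set.finrank] using finrank_range_le_card (R := K)
    (fun i : Fin r => C (e.symm (Sum.inr (Sum.inl i))))

theorem rowSpace_mul {K : Type*} [Field K] {l n m : ℕ} (A : Matrix (Fin l) (Fin n) K)
    (X : Matrix (Fin n) (Fin m) K) : rowSpace (A * X) = (rowSpace A).map X.vecMulLinear := by
  rw [rowSpace, rowSpace, Submodule.map_span, ← Set.range_comp]
  rfl

theorem finrank_rowSpace {K : Type*} [Field K] {n m : ℕ} (X : Matrix (Fin n) (Fin m) K) :
    Module.finrank K (rowSpace X) = X.rank :=
  X.rank_eq_finrank_span_row.symm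

/-- Sylvester's rank inequality. -/
theorem rank_add_rank_le_add_rank_mul {K : Type*} [Field K] {l n m : ℕ}
    (A : Matrix (Fin l) (Fin n) K) (X : Matrix (Fin n) (Fin m) K) :
    A.rank + X.rank ≤ n + (A * X).rank := by
  have h := finrank_map_add_finrank_ker_inf X.vecMulLinear (rowSpace A)
  rw [← rowSpace_mul, finrank_rowSpace, finrank_rowSpace] at h
  have hle : Module.finrank K ↥(LinearMap.ker X.vecMulLinear ⊓ rowSpace A) ≤
      Module.finrank K (LinearMap.ker X.vecMulLinear) := Submodule.finrank_mono inf_le_left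
  have hker := LinearMap.finrank_range_add_finrank_ker X.vecMulLinear
  rw [range_vecMulLinear X, ← X.rank_eq_finrank_span_row] at hker
  simp only [Module.finrank_fintype_fun_eq_card, Fintype.card_fin] at hker
  omega

/-- If `A` has corank at most `ρ`, then the rank of `B * Y - A * X` is at least
`rank X - ρ - dim (⟨X⟩ ∩ ⟨Y⟩)`. -/
theorem rank_le_add_rank_sub_add_finrank_inf {K : Type*} [Field K] {n m N L ρ : ℕ}
    (X : Matrix (Fin n) (Fin m) K) (Y : Matrix (Fin N) (Fin m) K)
    (A : Matrix (Fin L) (Fin n) K) (B : Matrix (Fin L) (Fin N) K) (hA : n - ρ ≤ A.rank) :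
    X.rank ≤ ρ + (B * Y - A * X).rank + Module.finrank K ↥(rowSpace X ⊓ rowSpace Y) := by
  have hle : ∀ {k : ℕ} (M : Matrix (Fin L) (Fin k) K) (Z : Matrix (Fin k) (Fin m) K),
      rowSpace (M * Z) ≤ rowSpace Z := fun M Z => by
    rw [rowSpace_mul]
    exact LinearMap.map_le_range.trans (range_vecMulLinear Z).le
  have hsup : rowSpace (A * X) ⊔ rowSpace Y ≤ rowSpace (B * Y - A * X) ⊔ rowSpace Y := by
    refine sup_le (Submodule.span_le.mpr ?_) le_sup_right
    rintro _ ⟨i, rfl⟩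
    have hi : (A * X) i = (B * Y) i - (B * Y - A * X) i := by
      ext j
      simp
    change (A * X) i ∈ _
    rw [hi]
    exact Submodule.sub_mem _
      (Submodule.mem_sup_right (hle B Y (Submodule.subset_span ⟨i, rfl⟩)))
      (Submodule.mem_sup_left (Submodule.subset_span ⟨i, rfl⟩))
  have h₁ := Submodule.finrank_mono hsup
  have h₂ := Submodule.finrank_add_le_finrank_add_finrank (rowSpace (B * Y - A * X)) (rowSpace Y)
  have h₃ := Submodule.finrank_sup_add_finrank_inf_eq (rowSpace (A * X)) (rowSpace Y)
  have h₄ := Submodule.finrank_mono (inf_le_inf_right (rowSpace Y) (hle A X))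
  have h₅ := rank_add_rank_le_add_rank_mul A X
  simp only [finrank_rowSpace] at h₁ h₂ h₃ h₄
  omega

/-- For `L ≥ max {n − ρ, N − σ}`, the minimum of `rank (BY − AX)` over all
`A ∈ 𝔽_q^{L×n}` with `rank A ≥ n − ρ` and `B ∈ 𝔽_q^{L×N}` with
`rank B ≥ N − σ` equals `[max {rank X − ρ, rank Y − σ} − dim(⟨X⟩ ∩ ⟨Y⟩)]⁺`;
in particular it is independent of `L`. -/
theorem min_rank_BY_sub_AX {K : Type*} [Field K] [Fintype K] {n m N : ℕ}
    (hn : 0 < n) (hm : 0 < m) (hN : 0 < N) (ρ σ L : ℕ)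
    (hL : max (n - ρ) (N - σ) ≤ L)
    (X : Matrix (Fin n) (Fin m) K) (Y : Matrix (Fin N) (Fin m) K) :
    ((sInf {r : ℕ | ∃ A : Matrix (Fin L) (Fin n) K, ∃ B : Matrix (Fin L) (Fin N) K,
        n - ρ ≤ A.rank ∧ N - σ ≤ B.rank ∧ r = (B * Y - A * X).rank} : ℕ) : ℤ) =
      max (max ((X.rank : ℤ) - ρ) ((Y.rank : ℤ) - σ)
        - (Module.finrank K ↥(rowSpace X ⊓ rowSpace Y) : ℤ)) 0 := by
  set D := Module.finrank K ↥(rowSpace X ⊓ rowSpace Y)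
  set R := max (X.rank - ρ) (Y.rank - σ) - D
  have hXn : X.rank ≤ n := X.rank_le_height
  have hYN : Y.rank ≤ N := Y.rank_le_height
  suffices h : IsLeast {r : ℕ | ∃ A : Matrix (Fin L) (Fin n) K, ∃ B : Matrix (Fin L) (Fin N) K,
      n - ρ ≤ A.rank ∧ N - σ ≤ B.rank ∧ r = (B * Y - A * X).rank} R by
    rw [h.csInf_eq]
    omega
  have hlow : ∀ (A : Matrix (Fin L) (Fin n) K) (B : Matrix (Fin L) (Fin N) K),
      n - ρ ≤ A.rank → N - σ ≤ B.rank → R ≤ (B * Y - A * X).rank := by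
    intro A B hA hB
    have h₁ := rank_le_add_rank_sub_add_finrank_inf X Y A B hA
    have h₂ := rank_le_add_rank_sub_add_finrank_inf Y X B A hB
    rw [inf_comm, ← neg_sub, ← neg_one_smul K,
      Matrix.rank_smul_of_mem_nonZeroDivisors _ (by simp)] at h₂
    omega
  refine ⟨?_, ?_⟩
  · let d := min D L
    let r := min R (L - d)
    let e : Fin L ≃ Fin d ⊕ Fin r ⊕ Fin (L - d - r) :=
      Fintype.equivOfCardEq (by simp; omega)
    let b := Module.finBasis K ↥(rowSpace X ⊓ rowSpace Y)
    let z : Fin d → Fin m → K := fun i => b (Fin.castLE (min_le_left D L) i)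
    have hz : LinearIndependent K z :=
      (b.linearIndependent.comp _ (Fin.castLE_injective (min_le_left D L))).map'
        (rowSpace X ⊓ rowSpace Y).subtype (Submodule.ker_subtype _)
    obtain ⟨A, hA, hAz, hA0⟩ := exists_matrix_rank_ge_mul_row_eq e X z hz
      (fun i => (b (Fin.castLE (min_le_left D L) i)).2.1) (n - ρ) (by omega) (by omega) (by omega)
    obtain ⟨B, hB, hBz, hB0⟩ := exists_matrix_rank_ge_mul_row_eq e Y z hz
      (fun i => (b (Fin.castLE (min_le_left D L) i)).2.2) (N - σ) (by omega) (by omega) (by omega)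
    refine ⟨A, B, hA, hB, le_antisymm (hlow A B hA hB) ?_⟩
    refine (rank_le_of_rows_eq_zero e _ (fun i => ?_) fun i => ?_).trans (min_le_left R (L - d))
    · change (B * Y) _ - (A * X) _ = 0
      rw [hAz, hBz, sub_self]
    · change (B * Y) _ - (A * X) _ = 0
      rw [hA0, hB0, sub_self]
  · rintro _ ⟨A, B, hA, hB, rfl⟩
    exact hlow A B hA hB
end
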